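/- arXiv:math/0303372 — 2 statements merged into one kernel-verified Lean document; each statement's English description precedes it below -/
import Mathlib

section
/- Let Λ be a reduced graded complete intersection affine k-algebra, let g = {g_1,…,g_t} ⊆ Λ be a complete intersection for Λ consisting of homogeneous elements, and let Γ = k[g_1,…,g_t]. Then there exists an open dense subset U_g ⊆ Sp Γ such that for every μ ∈ U_g the ideal I_μ = (g_1−g_1(μ),…,g_t−g_t(μ)) ⊆ Λ is radical, where g_i(μ) ∈ k denotes the value of g_i at the character μ of Γ. -/
open scoped TensorProduct

noncomputable section

universe u v w

/-- A sequence `g 0, …, g (t-1)` in a commutative ring is *regular* if for each `i`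
the class of `g i` in the quotient by the ideal generated by the previous elements
is neither a zero divisor nor invertible. -/
def IsRegularSequence {Λ : Type u} [CommRing Λ] {t : ℕ} (g : Fin t → Λ) : Prop :=
  ∀ i : Fin t,
    ((∀ x : Λ, g i * x ∈ Ideal.span (g '' {j | j < i}) → x ∈ Ideal.span (g '' {j | j < i})) ∧
      Ideal.span (g '' {j | j ≤ i}) ≠ ⊤)

/-- The `i`-th differential of the Koszul complex of a sequence `g` of elements in a
`k`-algebra `U`, where the `i`-th term of the complex is the free `U`-module on the
`i`-element subsets of `Fin t` (a model of `U ⊗ Λ^i k^t`), with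
`d (u ⊗ e_{j₁} ∧ … ∧ e_{jᵢ}) = Σ (-1)^(m-1) (u * g jₘ) ⊗ e_{j₁} ∧ … ∧ ê_{jₘ} ∧ … ∧ e_{jᵢ}`. -/
noncomputable def koszulD (k : Type u) {U : Type v} [CommRing k] [Ring U] [Algebra k U]
    {t : ℕ} (g : Fin t → U) (i : ℕ) :
    ({s : Finset (Fin t) // s.card = i + 1} →₀ U) →ₗ[k] ({s : Finset (Fin t) // s.card = i} →₀ U) :=
  Finsupp.lsum k fun s =>
    ∑ j ∈ s.1.attach,
      (Finsupp.lsingle (R := k)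
          (⟨s.1.erase j.1, by simp [Finset.card_erase_of_mem j.2, s.2]⟩ :
            {s : Finset (Fin t) // s.card = i})).comp
        (LinearMap.mulRight k (((-1 : U) ^ (s.1.filter fun a => a < j.1).card) * g j.1))

/-- A sequence `g` of (mutually commuting) elements of a `k`-algebra `U` is a
*complete intersection for `U`* if the Koszul homology `H_i(g, U)` vanishes for `i ≠ 0`
and `H_0(g, U) = U/(U g 0 + … + U g (t-1)) ≠ 0`. -/
def IsCompleteIntersection (k : Type u) {U : Type v} [CommRing k] [Ring U] [Algebra k U]
    {t : ℕ} (g : Fin t → U) : Prop :=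
  (∀ i : ℕ, LinearMap.ker (koszulD k g i) = LinearMap.range (koszulD k g (i + 1))) ∧
    Submodule.span U (Set.range g) ≠ ⊤

/-- The Zariski topology on the "maximal spectrum" `Sp Λ` of an affine algebra over an
algebraically closed field, modelled by the set of `k`-characters of `Λ`: a basis of open
sets is given by the sets `{χ | χ f ≠ 0}`. -/
instance spTopology (k : Type u) (R : Type v) [CommSemiring k] [Semiring R] [Algebra k R] :
    TopologicalSpace (R →ₐ[k] k) :=
  TopologicalSpace.generateFrom {s | ∃ f : R, s = {χ : R →ₐ[k] k | χ f ≠ 0}}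

/-- The zero set `V(S) ⊆ Sp Λ` of a set of elements of `Λ`. -/
def spZeroLocus (k : Type u) {R : Type v} [CommSemiring k] [Semiring R] [Algebra k R]
    (S : Set R) : Set (R →ₐ[k] k) :=
  {χ | ∀ f ∈ S, χ f = 0}

/-- The dimension of a subset of a topological space. -/
noncomputable def setDim {X : Type u} [TopologicalSpace X] (S : Set X) : WithBot ℕ∞ :=
  topologicalKrullDim S

/-- A subset of a topological space is equidimensional of dimension `d` if it is nonempty
and all its irreducible components have dimension `d`. -/
def EquidimOfDim {X : Type u} [TopologicalSpace X] (S : Set X) (d : ℕ) : Prop :=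
  S.Nonempty ∧ ∀ C ∈ irreducibleComponents S, topologicalKrullDim C = (d : WithBot ℕ∞)

/-- The Cohen-Macaulay property as used in the paper: for every proper ideal `I`,
the depth of `I` (maximal length of a regular sequence contained in `I`) equals the
codimension of `I` (the minimal codimension in `Sp Λ` of an irreducible component of
`V(I)`, i.e. `dim Sp Λ - dim V(I)`). -/
def IsPaperCM (k : Type u) (Λ : Type v) [Field k] [CommRing Λ] [Algebra k Λ] : Prop :=
  ∀ I : Ideal Λ, I ≠ ⊤ → ∃ c : ℕ,
    (setDim (spZeroLocus k (I : Set Λ)) + (c : WithBot ℕ∞) =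
      topologicalKrullDim (Λ →ₐ[k] k)) ∧
    (∃ g : Fin c → Λ, (∀ i, g i ∈ I) ∧ IsRegularSequence g) ∧
    (∀ (m : ℕ) (g : Fin m → Λ), (∀ i, g i ∈ I) → IsRegularSequence g → m ≤ c)

/-- An affine `k`-algebra is a *reduced complete intersection* if it is isomorphic to a
quotient of a polynomial algebra by a radical ideal generated by a regular sequence. -/
def IsReducedCI (k : Type u) (B : Type v) [Field k] [CommRing B] [Algebra k B] : Prop :=
  ∃ (n t : ℕ) (f : Fin t → MvPolynomial (Fin n) k) (I : Ideal (MvPolynomial (Fin n) k)),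
    I = Ideal.span (Set.range f) ∧ IsRegularSequence f ∧ I.IsRadical ∧
      Nonempty ((MvPolynomial (Fin n) k ⧸ I) ≃ₐ[k] B)

open MvPolynomial in
theorem MvPolynomial.exists_finite_subset_degree_le {A : Type*} [CommRing A] {n : ℕ}
    (m : MonomialOrder (Fin n)) (J : Ideal (MvPolynomial (Fin n) A)) :
    ∃ T : Finset (MvPolynomial (Fin n) A), (∀ q ∈ T, q ∈ J ∧ q ≠ 0) ∧
      ∀ p ∈ J, p ≠ 0 → ∃ q ∈ T, m.degree q ≤ m.degree p := by
  classical
  let D : Set (Fin n →₀ ℕ) := m.degree '' {q | q ∈ J ∧ q ≠ 0}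
  have hfin : {d | Minimal (· ∈ D) d}.Finite :=
    WellQuasiOrderedLE.finite_of_isAntichain (setOfPred_minimal_antichain _)
  choose! q hq using fun (d : Fin n →₀ ℕ) (hd : d ∈ D) => hd
  refine ⟨hfin.toFinset.image q, ?_, ?_⟩
  · intro x hx
    simp only [Finset.mem_image, Set.Finite.mem_toFinset] at hx
    obtain ⟨d, hd, rfl⟩ := hx
    exact (hq d hd.1).1
  · intro p hp hp0
    obtain ⟨d, hdp, hd⟩ := exists_minimal_le_of_wellFoundedLT (· ∈ D)
      (m.degree p) ⟨p, ⟨hp, hp0⟩, rfl⟩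
    refine ⟨q d, Finset.mem_image_of_mem _ (by simpa using hd), ?_⟩
    rwa [(hq d hd.1).2]

open MvPolynomial in
theorem MvPolynomial.exists_generic_complement {A : Type*} [CommRing A] [IsDomain A] {n : ℕ}
    (J : Ideal (MvPolynomial (Fin n) A)) :
    ∃ f : A, f ≠ 0 ∧ ∃ W : Submodule A (MvPolynomial (Fin n) A),
      (∀ w ∈ W, w ∈ J → w = 0) ∧ ∀ p, ∃ N : ℕ, ∃ j ∈ J, ∃ w ∈ W, f ^ N • p = j + w := by
  classical
  let m : MonomialOrder (Fin n) := MonomialOrder.lex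
  obtain ⟨T, hT, hTJ⟩ := exists_finite_subset_degree_le m J
  have hlc : ∏ q ∈ T, m.leadingCoeff q ≠ 0 :=
    Finset.prod_ne_zero_iff.mpr fun q hq => m.leadingCoeff_ne_zero_iff.mpr (hT q hq).2
  let W := restrictSupport A {d : Fin n →₀ ℕ | ∀ q ∈ T, ¬ m.degree q ≤ d}
  refine ⟨_, hlc, W, ?_, ?_⟩
  · intro w hw hwJ
    by_contra h
    obtain ⟨q, hq, hle⟩ := hTJ w hwJ h
    exact hw (m.degree_mem_support h) q hq hle
  set f := ∏ q ∈ T, m.leadingCoeff q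
  let P : MvPolynomial (Fin n) A → Prop := fun p => ∃ N : ℕ, ∃ j ∈ J, ∃ w ∈ W, f ^ N • p = j + w
  have hP0 : P 0 := ⟨0, 0, J.zero_mem, 0, W.zero_mem, by simp⟩
  suffices ∀ d : m.syn, ∀ p, m.toSyn (m.degree p) = d → P p from fun p => this _ p rfl
  intro d
  induction d using WellFoundedLT.induction with
  | ind d ih =>
    rintro p rfl
    by_cases h : ∃ q ∈ T, m.degree q ≤ m.degree p
    · obtain ⟨q, hq, hle⟩ := h
      have hs : P (m.sPolynomial p q) := by
        rcases m.degree_sPolynomial p q with h | h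
        · rw [sup_eq_left.mpr hle] at h
          exact ih _ h _ rfl
        · rwa [h]
      obtain ⟨N, j, hj, w, hw, e⟩ := hs
      obtain ⟨c, hc⟩ : m.leadingCoeff q ∣ f := Finset.dvd_prod_of_mem _ hq
      rw [MonomialOrder.sPolynomial, tsub_eq_zero_of_le hle] at e
      refine ⟨N + 1, C c * j + C (c * f ^ N) * (monomial (m.degree p - m.degree q)
        (m.leadingCoeff p) * q), ?_, c • w, W.smul_mem _ hw, ?_⟩
      · exact J.add_mem (J.mul_mem_left _ hj)
          (J.mul_mem_left _ (J.mul_mem_left _ (hT q hq).1))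
      · have hcf : (C f : MvPolynomial (Fin n) A) = C (m.leadingCoeff q) * C c := by
          rw [← C_mul, ← hc]
        simp only [smul_eq_C_mul, C_mul, C_pow, ← C_apply] at e ⊢
        rw [pow_succ]
        nth_rw 2 [hcf]
        linear_combination (C c) * e
    · have hs : P (p - m.leadingTerm p) := by
        by_cases h0 : p - m.leadingTerm p = 0
        · rwa [h0]
        · exact ih _ (m.degree_sub_leadingTerm_lt_iff.mpr
            (m.degree_ne_zero_of_sub_leadingTerm_ne_zero h0)) _ rfl
      obtain ⟨N, j, hj, w, hw, e⟩ := hs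
      refine ⟨N, j, hj, w + f ^ N • m.leadingTerm p, W.add_mem hw (W.smul_mem _ ?_), ?_⟩
      · push Not at h
        exact (monomial_mem_restrictSupport A).mpr (Or.inl h)
      · rw [← add_assoc, ← e, smul_sub, sub_add_cancel]

theorem Ideal.exists_generic_complement {A B : Type*} [CommRing A] [IsDomain A] [CommRing B]
    [Algebra A B] [Algebra.FiniteType A B] (J : Ideal B) :
    ∃ f : A, f ≠ 0 ∧ ∃ W : Submodule A B,
      (∀ w ∈ W, w ∈ J → w = 0) ∧ ∀ b, ∃ N : ℕ, ∃ j ∈ J, ∃ w ∈ W, f ^ N • b = j + w := by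
  obtain ⟨n, φ, hφ⟩ := (Algebra.FiniteType.iff_quotient_mvPolynomial'' (R := A) (S := B)).mp ‹_›
  obtain ⟨f, hf, W, hW, h⟩ := MvPolynomial.exists_generic_complement (J.comap φ)
  refine ⟨f, hf, W.map φ.toLinearMap, ?_, fun b => ?_⟩
  · rintro _ ⟨w, hw, rfl⟩ hJ
    rw [hW w hw hJ, map_zero]
  · obtain ⟨p, rfl⟩ := hφ b
    obtain ⟨N, j, hj, w, hw, e⟩ := h p
    exact ⟨N, φ j, hj, φ w, ⟨w, hw, rfl⟩, by rw [← map_smul, e, map_add]⟩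

/-- A nonzerodivisor of `B` stays a nonzerodivisor on the general closed fibre of `A → B`. -/
theorem Ideal.exists_mem_map_of_mul_mem_map {A B : Type*} [CommRing A] [IsDomain A] [CommRing B]
    [Algebra A B] [Algebra.FiniteType A B] (s : B) (hs : s ∈ nonZeroDivisors B) :
    ∃ f : A, f ≠ 0 ∧ ∀ P : Ideal A, P.IsMaximal → f ∉ P → ∀ b : B,
      s * b ∈ P.map (algebraMap A B) → b ∈ P.map (algebraMap A B) := by
  obtain ⟨f, hf, W, hW, h⟩ := Ideal.exists_generic_complement (A := A) (Ideal.span {s})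
  refine ⟨f, hf, fun P hP hfP b hb => ?_⟩
  have key : ∀ x ∈ P • (⊤ : Submodule A B), ∃ N : ℕ, ∃ c ∈ P.map (algebraMap A B), ∃ w ∈ W,
      f ^ N • x = s * c + w := by
    intro x hx
    induction hx using Submodule.smul_induction_on' with
    | smul a ha b _ =>
      obtain ⟨N, j, hj, w, hw, e⟩ := h b
      obtain ⟨c, rfl⟩ := Ideal.mem_span_singleton.mp hj
      refine ⟨N, algebraMap A B a * c, Ideal.mul_mem_right _ _ (Ideal.mem_map_of_mem _ ha),
        a • w, W.smul_mem _ hw, ?_⟩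
      rw [smul_comm, e, smul_add, Algebra.smul_def, Algebra.smul_def]
      ring
    | add x hx y hy ihx ihy =>
      obtain ⟨N, c, hc, w, hw, e⟩ := ihx
      obtain ⟨N', c', hc', w', hw', e'⟩ := ihy
      refine ⟨N + N', f ^ N' • c + f ^ N • c', ?_, f ^ N' • w + f ^ N • w',
        W.add_mem (W.smul_mem _ hw) (W.smul_mem _ hw'), ?_⟩
      · simp only [Algebra.smul_def]
        exact Ideal.add_mem _ (Ideal.mul_mem_left _ _ hc) (Ideal.mul_mem_left _ _ hc')
      · simp only [Algebra.smul_def, map_pow, pow_add, map_mul] at e e' ⊢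
        linear_combination (algebraMap A B f) ^ N' * e + (algebraMap A B f) ^ N * e'
  obtain ⟨N, c, hc, w, hw, e⟩ := key (s * b) (by rw [Ideal.smul_top_eq_map]; exact hb)
  have hw0 : w = 0 := hW w hw <| Ideal.mem_span_singleton'.mpr ⟨f ^ N • b - c, by
    rw [← sub_eq_iff_eq_add'.mpr e, Algebra.smul_def, Algebra.smul_def]
    ring⟩
  have hfb : f ^ N • b ∈ P.map (algebraMap A B) := by
    convert hc
    rw [← mul_cancel_left_mem_nonZeroDivisors hs, mul_smul_comm, e, hw0, add_zero]
  obtain ⟨a, p, hp, hap⟩ := hP.exists_inv (mt (hP.isPrime.mem_of_pow_mem N) hfP)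
  have hb' : b = algebraMap A B a * (f ^ N • b) + algebraMap A B p * b := by
    rw [Algebra.smul_def, ← mul_assoc, ← map_mul, ← add_mul, ← map_add, hap, map_one, one_mul]
  rw [hb']
  exact Ideal.add_mem _ (Ideal.mul_mem_left _ _ hfb)
    (Ideal.mul_mem_right _ _ (Ideal.mem_map_of_mem _ hp))

theorem Polynomial.integralClosure_eq_bot (F : Type*) [Field F] :
    integralClosure F (Polynomial F) = ⊥ := by
  refine eq_bot_iff.mpr fun p hp => Algebra.mem_bot.mpr ⟨p.coeff 0, ?_⟩
  have hdeg : p.natDegree = 0 := by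
    by_contra h
    refine p.transcendental h (mem_nonZeroDivisors_of_ne_zero ?_)
      ((mem_integralClosure_iff F _).mp hp).isAlgebraic
    rw [Polynomial.leadingCoeff_ne_zero]
    rintro rfl
    simp at h
  rw [Polynomial.eq_C_of_natDegree_eq_zero hdeg]
  simp

theorem Algebra.Smooth.isReduced_of_field (F S : Type*) [Field F] [CommRing S] [Algebra F S]
    [Algebra.Smooth F S] : IsReduced S := by
  refine ⟨fun n hn => ?_⟩
  let x : S ⊗[F] Polynomial F := n ⊗ₜ Polynomial.X
  have hx : IsIntegral S x := by
    obtain ⟨r, hr⟩ := hn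
    refine ⟨Polynomial.X ^ r, Polynomial.monic_X_pow r, ?_⟩
    simp [x, Algebra.TensorProduct.tmul_pow, hr]
  obtain ⟨y, hy⟩ := (TensorProduct.toIntegralClosure_bijective_of_smooth (R := F) (S := S)
    (B := Polynomial F)).2 ⟨x, hx⟩
  have h1 : ∀ y : S ⊗[F] integralClosure F (Polynomial F),
      (TensorProduct.rid F F S) (LinearMap.lTensor S (Polynomial.lcoeff F 1) 
      (TensorProduct.toIntegralClosure F S (Polynomial F) y : S ⊗[F] Polynomial F)) = 0 := by
    intro y
    induction y with
    | zero => simp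
    | add x y hx hy => simp only [map_add, Subalgebra.coe_add, hx, hy, add_zero]
    | tmul a b =>
      obtain ⟨b, hb⟩ := b
      have hb' := hb
      rw [Polynomial.integralClosure_eq_bot] at hb'
      obtain ⟨c, rfl⟩ := Algebra.mem_bot.mp hb'
      simp [TensorProduct.toIntegralClosure]
  have := h1 y
  rw [hy] at this
  simpa [x] using this

theorem Algebra.isSmoothAt_of_mem_minimalPrimes {A B : Type*} [CommRing A] [IsDomain A]
    [CharZero A] [CommRing B] [IsReduced B] [IsNoetherianRing B] [Algebra A B]
    [Algebra.FiniteType A B] (hB : ∀ a : A, a ≠ 0 → algebraMap A B a ∈ nonZeroDivisors B)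
    (q : Ideal B) [q.IsPrime] (hq : q ∈ minimalPrimes B) : Algebra.IsSmoothAt A q := by
  have : Ring.KrullDimLE 0 (Localization.AtPrime q) := .of_isLocalization q hq _
  have : IsNoetherianRing (Localization.AtPrime q) :=
    IsLocalization.isNoetherianRing q.primeCompl _ ‹_›
  have : IsArtinianRing (Localization.AtPrime q) :=
    isArtinianRing_iff_isNoetherianRing_krullDimLE_zero.mpr ⟨‹_›, ‹_›⟩
  let : Field (Localization.AtPrime q) :=
    (IsArtinianRing.isField_of_isReduced_of_isLocalRing _).toField
  have : FaithfulSMul A (Localization.AtPrime q) := by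
    refine (faithfulSMul_iff_algebraMap_injective _ _).mpr
      ((injective_iff_map_eq_zero _).mpr fun a ha => ?_)
    by_contra h
    rw [IsScalarTower.algebraMap_apply A B] at ha
    refine notMem_nonZeroDivisors_of_mem_mem_minimalPrimes ?_ hq (hB a h)
    by_contra hmem
    exact (IsLocalization.map_units (Localization.AtPrime q)
      (⟨_, hmem⟩ : q.primeCompl)).ne_zero ha
  let := FractionRing.liftAlgebra A (Localization.AtPrime q)
  have : CharZero (FractionRing A) :=
    charZero_of_injective_algebraMap (IsFractionRing.injective A (FractionRing A))
  have : Algebra.EssFiniteType B (Localization.AtPrime q) :=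
    Algebra.EssFiniteType.of_isLocalization _ q.primeCompl
  have : Algebra.EssFiniteType A (Localization.AtPrime q) := .comp A B _
  have : Algebra.EssFiniteType (FractionRing A) (Localization.AtPrime q) := .of_comp A _ _
  have : Algebra.FormallySmooth (FractionRing A) (Localization.AtPrime q) :=
    .of_perfectField
  have : Algebra.FormallyEtale A (FractionRing A) := .of_isLocalization (nonZeroDivisors A)
  exact Algebra.FormallySmooth.comp A (FractionRing A) _

theorem Algebra.exists_smooth_away {A B : Type*} [CommRing A] [IsDomain A] [IsNoetherianRing A]
    [CharZero A] [CommRing B] [IsReduced B] [Algebra A B]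
    [Algebra.FiniteType A B] (hB : ∀ a : A, a ≠ 0 → algebraMap A B a ∈ nonZeroDivisors B) :
    ∃ s ∈ nonZeroDivisors B, Algebra.Smooth A (Localization.Away s) := by
  have : IsNoetherianRing B := Algebra.FiniteType.isNoetherianRing A B
  have : Algebra.FinitePresentation A B := Algebra.FinitePresentation.of_finiteType.mp ‹_›
  obtain ⟨J, hJ⟩ := (PrimeSpectrum.isClosed_iff_zeroLocus_ideal _).mp
    (Algebra.isOpen_smoothLocus (R := A) (A := B)).isClosed_compl
  have hnot : ¬ (J : Set B) ⊆ ⋃ q ∈ minimalPrimes B, (q : Set B) := by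
    rw [Ideal.subset_union_prime_finite (minimalPrimes.finite_of_isNoetherianRing B) ⊥ ⊥
      fun q hq _ _ => Ideal.IsMinimalPrime.isPrime hq]
    rintro ⟨q, hq, hle⟩
    have hqp : q.IsPrime := Ideal.IsMinimalPrime.isPrime hq
    have : (⟨q, hqp⟩ : PrimeSpectrum B) ∈ (Algebra.smoothLocus A B)ᶜ := by
      rw [hJ]
      exact hle
    exact this (Algebra.isSmoothAt_of_mem_minimalPrimes hB q hq)
  obtain ⟨s, hsJ, hs⟩ := Set.not_subset.mp hnot
  refine ⟨s, ?_, Algebra.basicOpen_subset_smoothLocus_iff_smooth.mp ?_⟩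
  · refine mem_nonZeroDivisors_iff_right.mpr fun b hb => ?_
    have : b ∈ nilradical B := by
      rw [nilradical, ← Ideal.sInf_minimalPrimes]
      refine Ideal.mem_sInf.mpr fun {q} hq => ?_
      refine ((Ideal.IsMinimalPrime.isPrime hq).mem_or_mem (hb ▸ q.zero_mem)).resolve_right
        fun h => hs (Set.mem_biUnion hq h)
    simpa using this
  · intro p hp
    by_contra h
    have : p ∈ (Algebra.smoothLocus A B)ᶜ := h
    rw [hJ] at this
    exact hp (this hsJ)

theorem Ideal.isRadical_map_of_smooth {A B : Type*} [CommRing A] [CommRing B] [Algebra A B]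
    [Algebra.Smooth A B] (P : Ideal A) [P.IsMaximal] : (P.map (algebraMap A B)).IsRadical := by
  let := Ideal.Quotient.field P
  have := Algebra.Smooth.isReduced_of_field (A ⧸ P) ((A ⧸ P) ⊗[A] B)
  rw [Ideal.isRadical_iff_quotient_reduced]
  exact isReduced_of_injective (Algebra.TensorProduct.quotIdealMapEquivQuotTensor B P)
    (AlgEquiv.injective _)

/-- The general closed fibre of a reduced algebra of finite type over a Noetherian domain of
characteristic zero is reduced. -/
theorem Ideal.exists_isRadical_map {A B : Type*} [CommRing A] [IsDomain A] [IsNoetherianRing A]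
    [CharZero A] [CommRing B] [IsReduced B] [Algebra A B]
    [Algebra.FiniteType A B] (hB : ∀ a : A, a ≠ 0 → algebraMap A B a ∈ nonZeroDivisors B) :
    ∃ f : A, f ≠ 0 ∧ ∀ P : Ideal A, P.IsMaximal → f ∉ P →
      (P.map (algebraMap A B)).IsRadical := by
  obtain ⟨s, hs, hsm⟩ := Algebra.exists_smooth_away hB
  obtain ⟨f, hf, hfP⟩ := Ideal.exists_mem_map_of_mul_mem_map (A := A) s hs
  refine ⟨f, hf, fun P hP hmem b ⟨n, hb⟩ => ?_⟩
  have hpow : ∀ (N : ℕ) (b : B), s ^ N * b ∈ P.map (algebraMap A B) →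
      b ∈ P.map (algebraMap A B) := by
    intro N
    induction N with
    | zero => intro b hb; simpa using hb
    | succ N ih => exact fun b hb => hfP P hP hmem b (ih _ (by rwa [← mul_assoc, ← pow_succ]))
  have hrad := Ideal.isRadical_map_of_smooth (B := Localization.Away s) P
  rw [IsScalarTower.algebraMap_eq A B (Localization.Away s), ← Ideal.map_map] at hrad
  have hb' := hrad (x := algebraMap B _ b) ⟨n, by
    rw [← map_pow]
    exact Ideal.mem_map_of_mem _ hb⟩
  obtain ⟨m, ⟨N, rfl⟩, hm⟩ := (IsLocalization.algebraMap_mem_map_algebraMap_iff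
    (Submonoid.powers s) _ _ _).mp hb'
  exact hpow N b hm

theorem exists_dvd_isRadical_map_ker (k : Type*) {Γ Λ : Type*} [Field k] [CharZero k]
    [CommRing Γ] [CommRing Λ] [IsReduced Λ] [Algebra k Γ] [Algebra k Λ] [Algebra Γ Λ]
    [IsScalarTower k Γ Λ] [FaithfulSMul Γ Λ] [Algebra.FiniteType k Γ] [Algebra.FiniteType k Λ]
    (e : Γ) (he : e ≠ 0) :
    ∃ h : Γ, h ≠ 0 ∧ e ∣ h ∧ ∀ μ : Γ →ₐ[k] k, μ h ≠ 0 →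
      ((RingHom.ker μ).map (algebraMap Γ Λ)).IsRadical := by
  have hφ : Function.Injective (algebraMap Γ Λ) := FaithfulSMul.algebraMap_injective Γ Λ
  have : IsNoetherianRing Λ := Algebra.FiniteType.isNoetherianRing k Λ
  have : IsNoetherianRing Γ := Algebra.FiniteType.isNoetherianRing k Γ
  let ann : Γ → Ideal Λ := fun h => LinearMap.ker (LinearMap.mulLeft Λ (algebraMap Γ Λ h))
  have mem_ann : ∀ h x, x ∈ ann h ↔ algebraMap Γ Λ h * x = 0 := fun h x => Iff.rfl
  obtain ⟨_, ⟨h, ⟨heh, h0⟩, rfl⟩, hmax⟩ := set_has_maximal_iff_noetherian.mpr ‹IsNoetherianRing Λ›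
    (ann '' {h | e ∣ h ∧ h ≠ 0}) ⟨_, e, ⟨dvd_rfl, he⟩, rfl⟩
  let I := ann h
  have htf : ∀ a : Γ, algebraMap Γ Λ a ∉ I → ∀ x, algebraMap Γ Λ a * x ∈ I → x ∈ I := by
    intro a ha x hx
    have hle : ann h ≤ ann (h * a) := fun y hy => by
      rw [mem_ann] at hy ⊢
      rw [map_mul, mul_right_comm, hy, zero_mul]
    have hne : h * a ≠ 0 := fun h' => ha <| (mem_ann _ _).mpr <| by rw [← map_mul, h', map_zero]
    have heq : ann h = ann (h * a) := hle.eq_of_not_lt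
      (hmax _ ⟨h * a, ⟨heh.mul_right a, hne⟩, rfl⟩)
    change x ∈ ann h
    rw [heq, mem_ann, map_mul, mul_assoc]
    exact hx
  let p : Ideal Γ := I.comap (algebraMap Γ Λ)
  have hp : p.IsPrime := by
    refine ⟨fun h1 => ?_, fun {a b} hab => ?_⟩
    · have : algebraMap Γ Λ 1 ∈ I := Ideal.mem_comap.mp (h1.symm ▸ Submodule.mem_top : (1 : Γ) ∈ p)
      rw [map_one, mem_ann, mul_one] at this
      exact h0 (hφ (this.trans (map_zero _).symm))
    · refine or_iff_not_imp_left.mpr fun ha => htf a ha _ ?_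
      rw [← map_mul]
      exact hab
  have hred : IsReduced (Λ ⧸ I) := by
    rw [← Ideal.isRadical_iff_quotient_reduced]
    rintro x ⟨n, hn⟩
    rw [mem_ann] at hn ⊢
    refine eq_zero_of_pow_eq_zero (n := n + 1) ?_
    linear_combination (algebraMap Γ Λ h) ^ n * x * hn
  have : CharZero (Γ ⧸ p) := charZero_of_injective_algebraMap (algebraMap k (Γ ⧸ p)).injective
  have : IsScalarTower k (Γ ⧸ p) (Λ ⧸ I) := .of_algebraMap_eq fun c => by
    change Ideal.Quotient.mk I (algebraMap k Λ c) =
      Ideal.Quotient.mk I (algebraMap Γ Λ (algebraMap k Γ c))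
    rw [← IsScalarTower.algebraMap_apply]
  have : Algebra.FiniteType (Γ ⧸ p) (Λ ⧸ I) := .of_restrictScalars_finiteType k _ _
  obtain ⟨f, hf, hfP⟩ := Ideal.exists_isRadical_map (A := Γ ⧸ p) (B := Λ ⧸ I) <| by
    intro a ha
    obtain ⟨a, rfl⟩ := Ideal.Quotient.mk_surjective a
    refine mem_nonZeroDivisors_iff_right.mpr fun b hb => ?_
    obtain ⟨b, rfl⟩ := Ideal.Quotient.mk_surjective b
    change Ideal.Quotient.mk I b * Ideal.Quotient.mk I (algebraMap Γ Λ a) = 0 at hb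
    rw [← map_mul, Ideal.Quotient.eq_zero_iff_mem, mul_comm] at hb
    exact Ideal.Quotient.eq_zero_iff_mem.mpr
      (htf a (fun h => ha (Ideal.Quotient.eq_zero_iff_mem.mpr h)) b hb)
  obtain ⟨f, rfl⟩ := Ideal.Quotient.mk_surjective f
  refine ⟨h * f, fun hhf => hf (Ideal.Quotient.eq_zero_iff_mem.mpr ?_), heh.mul_right f,
    fun μ hμ => ?_⟩
  · change algebraMap Γ Λ f ∈ I
    rw [mem_ann, ← map_mul, hhf, map_zero]
  rw [map_mul, mul_ne_zero_iff] at hμ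
  obtain ⟨hμh, hμf⟩ := hμ
  have hpμ : p ≤ RingHom.ker μ := fun a ha => by
    have ha' : h * a = 0 := hφ (by rw [map_mul, map_zero]; exact ha)
    have := congrArg μ ha'
    rw [map_mul, map_zero] at this
    exact (mul_eq_zero.mp this).resolve_left hμh
  have hsurj : Function.Surjective μ := fun c => ⟨algebraMap k Γ c, by simp⟩
  have hmaxμ : (RingHom.ker μ).IsMaximal := RingHom.ker_isMaximal_of_surjective μ hsurj
  have hker : ((RingHom.ker μ).map (Ideal.Quotient.mk p)).comap (Ideal.Quotient.mk p) =
      RingHom.ker μ := by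
    rw [Ideal.comap_map_of_surjective' _ Ideal.Quotient.mk_surjective, Ideal.mk_ker,
      sup_eq_left.mpr hpμ]
  have hmaxP : ((RingHom.ker μ).map (Ideal.Quotient.mk p)).IsMaximal := by
    refine (Ideal.map_eq_top_or_isMaximal_of_surjective _ Ideal.Quotient.mk_surjective
      hmaxμ).resolve_left fun htop => hmaxμ.ne_top ?_
    rw [← hker, htop, Ideal.comap_top]
  have hrad := hfP _ hmaxP fun hmem => hμf <| by
    rw [← RingHom.mem_ker, ← hker]
    exact hmem
  have hmap : ((RingHom.ker μ).map (Ideal.Quotient.mk p)).map (algebraMap (Γ ⧸ p) (Λ ⧸ I)) =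
      ((RingHom.ker μ).map (algebraMap Γ Λ)).map (Ideal.Quotient.mk I) := by
    rw [Ideal.map_map, Ideal.map_map]
    rfl
  have hIle : I ≤ (RingHom.ker μ).map (algebraMap Γ Λ) := fun x hx => by
    have h1 : algebraMap Γ Λ (h - algebraMap k Γ (μ h)) ∈
        (RingHom.ker μ).map (algebraMap Γ Λ) :=
      Ideal.mem_map_of_mem _ (by simp [RingHom.mem_ker])
    have hx' : x = -(algebraMap k Λ (μ h)⁻¹ * x) * algebraMap Γ Λ (h - algebraMap k Γ (μ h)) := by
      rw [map_sub, ← IsScalarTower.algebraMap_apply]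
      have h2 : algebraMap k Λ (μ h)⁻¹ * algebraMap k Λ (μ h) = 1 := by
        rw [← map_mul, inv_mul_cancel₀ hμh, map_one]
      rw [mem_ann] at hx
      linear_combination algebraMap k Λ (μ h)⁻¹ * hx - x * h2
    rw [hx']
    exact Ideal.mul_mem_left _ _ h1
  rw [hmap] at hrad
  have := hrad.comap (Ideal.Quotient.mk I)
  rwa [Ideal.comap_map_of_surjective' _ Ideal.Quotient.mk_surjective, Ideal.mk_ker,
    sup_eq_left.mpr hIle] at this

theorem exists_algHom_apply_ne_zero {k R : Type*} [Field k] [IsAlgClosed k] [CommRing R]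
    [Algebra k R] [Algebra.FiniteType k R] (r : R) (hr : ¬ IsNilpotent r) :
    ∃ χ : R →ₐ[k] k, χ r ≠ 0 := by
  have : IsJacobsonRing R := isJacobsonRing_of_finiteType (A := k)
  have hjac : r ∉ (⊥ : Ideal R).jacobson := by
    rwa [← Ideal.radical_eq_jacobson]
  obtain ⟨M, ⟨-, hM⟩, hrM⟩ : ∃ M : Ideal R, (⊥ ≤ M ∧ M.IsMaximal) ∧ r ∉ M := by
    simpa [Ideal.jacobson, Ideal.mem_sInf] using hjac
  let := Ideal.Quotient.field M
  have : Module.Finite k (R ⧸ M) := finite_of_finite_type_of_isJacobsonRing k (R ⧸ M)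
  let ψ : (R ⧸ M) →ₐ[k] k := IsAlgClosed.lift
  refine ⟨ψ.comp (Ideal.Quotient.mkₐ k M), fun h => hrM (Ideal.Quotient.eq_zero_iff_mem.mp ?_)⟩
  exact (map_eq_zero ψ).mp h

theorem isTopologicalBasis_spTopology (k : Type u) (R : Type v) [Field k] [CommRing R]
    [Algebra k R] : TopologicalSpace.IsTopologicalBasis
      {s | ∃ f : R, s = {χ : R →ₐ[k] k | χ f ≠ 0}} where
  exists_subset_inter := by
    rintro _ ⟨f, rfl⟩ _ ⟨f', rfl⟩ χ ⟨h, h'⟩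
    refine ⟨_, ⟨f * f', rfl⟩, ?_, fun ψ hψ => ?_⟩
    · simpa using ⟨h, h'⟩
    · simpa using hψ
  sUnion_eq := Set.eq_univ_of_forall fun χ => ⟨_, ⟨1, rfl⟩, by simp⟩
  eq_generateFrom := rfl

theorem map_ker_eq_span_sub {k : Type*} {Λ ι : Type*} [Field k] [CommRing Λ] [Algebra k Λ]
    (g : ι → Λ) (μ : Algebra.adjoin k (Set.range g) →ₐ[k] k) :
    (RingHom.ker μ).map (algebraMap (Algebra.adjoin k (Set.range g)) Λ) =
      Ideal.span (Set.range fun i => g i - algebraMap k Λ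
        (μ ⟨g i, Algebra.subset_adjoin (Set.mem_range_self i)⟩)) := by
  set J := Ideal.span (Set.range fun i => g i - algebraMap k Λ
    (μ ⟨g i, Algebra.subset_adjoin (Set.mem_range_self i)⟩)) with hJ
  refine le_antisymm (Ideal.map_le_iff_le_comap.mpr fun γ hγ => ?_) (Ideal.span_le.mpr ?_)
  · have key : (Ideal.Quotient.mkₐ k J).comp (Algebra.adjoin k (Set.range g)).val =
        (Algebra.ofId k (Λ ⧸ J)).comp μ := by
      refine AlgHom.adjoin_ext ?_
      rintro _ ⟨i, rfl⟩
      change Ideal.Quotient.mk J (g i) = Ideal.Quotient.mk J (algebraMap k Λ _)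
      exact Ideal.Quotient.eq.mpr (Ideal.subset_span ⟨i, rfl⟩)
    have h := DFunLike.congr_fun key γ
    rw [AlgHom.comp_apply, AlgHom.comp_apply, RingHom.mem_ker.mp hγ, map_zero] at h
    exact Ideal.mem_comap.mpr (Ideal.Quotient.eq_zero_iff_mem (I := J).mp h)
  · rintro _ ⟨i, rfl⟩
    let γ : Algebra.adjoin k (Set.range g) := ⟨g i, Algebra.subset_adjoin (Set.mem_range_self i)⟩
    exact Ideal.mem_map_of_mem (algebraMap (Algebra.adjoin k (Set.range g)) Λ)
      (x := γ - algebraMap k _ (μ γ)) (by simp [RingHom.mem_ker])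

theorem IsReducedCI.isReduced {k : Type u} {B : Type v} [Field k] [CommRing B] [Algebra k B]
    (h : IsReducedCI k B) : IsReduced B := by
  obtain ⟨n, t, f, I, -, -, hI, ⟨e⟩⟩ := h
  have := I.isRadical_iff_quotient_reduced.mp hI
  exact isReduced_of_injective e.symm e.symm.injective

/-- Let `Λ` be a reduced graded complete intersection affine `k`-algebra,
`g = {g 1, …, g t} ⊆ Λ` a complete intersection for `Λ` of homogeneous elements, and
`Γ = k[g 1, …, g t]`. Then there is an open dense subset `U_g ⊆ Sp Γ` such that for every
`μ ∈ U_g` the ideal `I_μ = (g 1 − g 1(μ), …, g t − g t(μ)) ⊆ Λ` is radical. -/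
theorem statement13 {k : Type u} {Λ : Type v} [Field k] [IsAlgClosed k] [CharZero k]
    [CommRing Λ] [Nontrivial Λ] [Algebra k Λ] [Algebra.FiniteType k Λ]
    (𝒜 : ℕ → Submodule k Λ) [GradedAlgebra 𝒜] (h0 : 𝒜 0 = 1)
    (hredCI : IsReducedCI k Λ)
    {t : ℕ} (g : Fin t → Λ) (d : Fin t → ℕ) (hhom : ∀ i, g i ∈ 𝒜 (d i))
    (hCI : IsCompleteIntersection k g) :
    ∃ Us : Set (↥(Algebra.adjoin k (Set.range g)) →ₐ[k] k),
      IsOpen Us ∧ Dense Us ∧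
        ∀ μ ∈ Us,
          (Ideal.span (Set.range fun i =>
            g i - algebraMap k Λ
              (μ ⟨g i, Algebra.subset_adjoin (Set.mem_range_self i)⟩))).IsRadical := by
  have : IsReduced Λ := hredCI.isReduced
  have : Algebra.FiniteType k (Algebra.adjoin k (Set.range g)) :=
    .adjoin_of_finite (Set.finite_range g)
  let Γ := Algebra.adjoin k (Set.range g)
  have : IsReduced Γ := isReduced_of_injective Γ.val Subtype.val_injective
  let H : Set Γ := {h | ∀ μ : Γ →ₐ[k] k, μ h ≠ 0 →
    ((RingHom.ker μ).map (algebraMap Γ Λ)).IsRadical}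
  refine ⟨⋃ h ∈ H, {χ | χ h ≠ 0}, ?_, ?_, ?_⟩
  · exact isOpen_biUnion fun h _ => TopologicalSpace.isOpen_generateFrom_of_mem ⟨h, rfl⟩
  · rw [(isTopologicalBasis_spTopology k Γ).dense_iff]
    rintro _ ⟨e, rfl⟩ ⟨χ, hχ⟩
    have he : e ≠ 0 := by
      rintro rfl
      exact hχ (map_zero χ)
    obtain ⟨h, h0, heh, hH⟩ := exists_dvd_isRadical_map_ker k (Λ := Λ) e he
    obtain ⟨ψ, hψ⟩ := exists_algHom_apply_ne_zero (k := k) h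
      fun hnil => h0 (isNilpotent_iff_eq_zero.mp hnil)
    refine ⟨ψ, fun h' => hψ ?_, Set.mem_biUnion (show h ∈ H from hH) hψ⟩
    exact zero_dvd_iff.mp (h' ▸ map_dvd ψ heh)
  · intro μ hμ
    obtain ⟨h, hH, hμh⟩ := Set.mem_iUnion₂.mp hμ
    rw [← map_ker_eq_span_sub]
    exact hH μ hμh

end
end

section
/- Let n, p ≥ 1 and let Λ = k[X_ij^(k) : 1 ≤ i,j ≤ n, 1 ≤ k ≤ p] be the polynomial algebra in n²p variables. For each i,j set X_ij(u) = δ_ij u^p + Σ_{k=1}^p X_ij^(k) u^{p−k} ∈ Λ[u], let X(u) be the n×n matrix (X_ij(u)), and for s = 1,…,np let d̄_s ∈ Λ be the coefficient of u^{np−s} in det X(u). Then the sequence d̄_1,…,d̄_{np} is a regular sequence in Λ (equivalently, since the d̄_s are homogeneous with respect to the grading deg X_ij^(k) = k, a complete intersection for Λ). -/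
open scoped TensorProduct

noncomputable section

universe u v w

/-- The first `N` terms of `g` form a weakly regular sequence: each is a nonzerodivisor modulo the
ideal generated by the preceding ones. -/
def WeaklyRegularUpTo {A : Type*} [CommRing A] (g : ℕ → A) (N : ℕ) : Prop :=
  ∀ n < N, ∀ x, g n * x ∈ Ideal.span (g '' Set.Iio n) → x ∈ Ideal.span (g '' Set.Iio n)

theorem Ideal.span_image_Iio_succ {A : Type*} [CommRing A] (g : ℕ → A) (n : ℕ) :
    Ideal.span (g '' Set.Iio (n + 1)) = Ideal.span (insert (g n) (g '' Set.Iio n)) := by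
  rw [← Set.image_insert_eq]
  congr 2
  ext m
  simp only [Set.mem_Iio, Set.mem_insert_iff]
  lia

/-- A ring homomorphism is ideal-pure if every ideal of the source is contracted from its
extension. -/
def RingHom.IdealPure {A B : Type*} [CommRing A] [CommRing B] (f : A →+* B) : Prop :=
  ∀ (I : Ideal A) (x : A), f x ∈ I.map f → x ∈ I

namespace RingHom.IdealPure

variable {A B C : Type*} [CommRing A] [CommRing B] [CommRing C]

theorem of_leftInverse (f : A →+* B) (g : B →+* A) (h : ∀ x, g (f x) = x) : f.IdealPure := by
  intro I x hx
  have hgf : g.comp f = RingHom.id A := RingHom.ext h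
  have := Ideal.mem_map_of_mem g hx
  rwa [Ideal.map_map, hgf, Ideal.map_id, h] at this

theorem comp {g : B →+* C} {f : A →+* B} (hg : g.IdealPure) (hf : f.IdealPure) :
    (g.comp f).IdealPure := by
  intro I x hx
  rw [← Ideal.map_map] at hx
  exact hf I x (hg _ _ hx)

theorem of_comp {g : B →+* C} {f : A →+* B} (h : (g.comp f).IdealPure) : f.IdealPure := by
  intro I x hx
  refine h I x ?_
  rw [← Ideal.map_map]
  exact Ideal.mem_map_of_mem g hx

theorem weaklyRegularUpTo {f : A →+* B} (hf : f.IdealPure) {g : ℕ → A} {N : ℕ}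
    (h : WeaklyRegularUpTo (fun n => f (g n)) N) : WeaklyRegularUpTo g N := by
  intro n hn x hx
  apply hf
  have key : (Ideal.span (g '' Set.Iio n)).map f =
      Ideal.span ((fun n => f (g n)) '' Set.Iio n) := by
    rw [Ideal.map_span, Set.image_image]
  have := Ideal.mem_map_of_mem f hx
  rw [key, map_mul] at this
  rw [key]
  exact h n hn _ this

end RingHom.IdealPure

section Filtration

variable {A σ : Type*} [CommRing A] [SetLike σ A] [AddSubmonoidClass σ A] (𝒜 : ℕ → σ)
  [GradedRing 𝒜]

/-- The elements all of whose homogeneous components have degree less than `m`. -/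
def degLT (m : ℕ) : AddSubgroup A where
  carrier := {x | ∀ j, m ≤ j → GradedRing.proj 𝒜 j x = 0}
  zero_mem' := by simp
  add_mem' := by
    intro a b ha hb j hj
    rw [map_add, ha j hj, hb j hj, add_zero]
  neg_mem' := by
    intro a ha j hj
    rw [map_neg, ha j hj, neg_zero]

variable {𝒜}

theorem degLT_mono {m n : ℕ} (h : m ≤ n) : degLT 𝒜 m ≤ degLT 𝒜 n :=
  fun _ hx j hj => hx j (h.trans hj)

theorem eq_sum_proj_of_mem_degLT {m : ℕ} {x : A} (hx : x ∈ degLT 𝒜 m) :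
    x = ∑ j ∈ Finset.range m, GradedRing.proj 𝒜 j x := by
  classical
  conv_lhs => rw [← DirectSum.sum_support_decompose 𝒜 x]
  apply Finset.sum_subset
  · intro j hj
    rw [Finset.mem_range]
    by_contra hjm
    have := hx j (not_lt.mp hjm)
    rw [GradedRing.proj_apply] at this
    simp at hj
    exact hj (Subtype.ext this)
  · intro j _ hj
    simpa using hj

theorem eq_zero_of_mem_degLT_zero {x : A} (hx : x ∈ degLT 𝒜 0) : x = 0 := by
  simpa using eq_sum_proj_of_mem_degLT hx

variable (𝒜) in
theorem exists_mem_degLT (x : A) : ∃ m, x ∈ degLT 𝒜 m := by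
  classical
  refine ⟨(DirectSum.decompose 𝒜 x).support.sup id + 1, fun j hj => ?_⟩
  rw [GradedRing.proj_apply]
  by_contra h
  have hmem : j ∈ (DirectSum.decompose 𝒜 x).support := by simpa using h
  have := Finset.le_sup (f := id) hmem
  simp only [id] at this
  lia

theorem mem_degLT_of_succ {m : ℕ} {x : A} (hx : x ∈ degLT 𝒜 (m + 1))
    (h : GradedRing.proj 𝒜 m x = 0) : x ∈ degLT 𝒜 m := by
  intro j hj
  rcases hj.eq_or_lt with rfl | hj
  · exact h
  · exact hx j hj

theorem proj_mul_of_mem {d : ℕ} {c : A} (hc : c ∈ 𝒜 d) (x : A) (j : ℕ) :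
    GradedRing.proj 𝒜 (d + j) (c * x) = c * GradedRing.proj 𝒜 j x :=
  DirectSum.coe_decompose_mul_add_of_left_mem 𝒜 hc

theorem proj_mul_of_mem_of_lt {d : ℕ} {c : A} (hc : c ∈ 𝒜 d) (x : A) {j : ℕ} (hj : j < d) :
    GradedRing.proj 𝒜 j (c * x) = 0 :=
  DirectSum.coe_decompose_mul_of_left_mem_of_not_le 𝒜 hc (not_le.mpr hj)

theorem mul_mem_degLT_of_mem {d m : ℕ} {c x : A} (hc : c ∈ 𝒜 d) (hx : x ∈ degLT 𝒜 m) :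
    c * x ∈ degLT 𝒜 (d + m) := by
  intro j hj
  obtain ⟨i, rfl⟩ := Nat.exists_eq_add_of_le (le_trans (Nat.le_add_right d m) hj)
  rw [proj_mul_of_mem hc, hx i (by lia), mul_zero]

theorem proj_mem (j : ℕ) (x : A) : GradedRing.proj 𝒜 j x ∈ 𝒜 j :=
  SetLike.coe_mem _

theorem mul_mem_degLT {a b m : ℕ} {x y : A} (hx : x ∈ degLT 𝒜 a) (hy : y ∈ degLT 𝒜 b)
    (h : a + b ≤ m + 1) : x * y ∈ degLT 𝒜 m := by
  rw [eq_sum_proj_of_mem_degLT hx, Finset.sum_mul]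
  refine sum_mem fun i hi => degLT_mono ?_ (mul_mem_degLT_of_mem (proj_mem i x) hy)
  rw [Finset.mem_range] at hi
  lia

theorem mem_degLT_succ_of_mem {d : ℕ} {c : A} (hc : c ∈ 𝒜 d) : c ∈ degLT 𝒜 (d + 1) := by
  intro j hj
  rw [GradedRing.proj_apply]
  exact DirectSum.decompose_of_mem_ne 𝒜 hc (by lia)

theorem proj_self_of_mem {d : ℕ} {c : A} (hc : c ∈ 𝒜 d) : GradedRing.proj 𝒜 d c = c := by
  rw [GradedRing.proj_apply]
  exact DirectSum.decompose_of_mem_same 𝒜 hc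

section LeadingForm

variable {g c : ℕ → A} {D : ℕ → ℕ}

theorem mul_mem_degLT_of_leadingForm {n d : ℕ} {x : A} (hc : c n ∈ 𝒜 (D n))
    (hg : g n - c n ∈ degLT 𝒜 (D n)) (hx : x ∈ degLT 𝒜 (d + 1)) :
    g n * x ∈ degLT 𝒜 (D n + d + 1) ∧
      GradedRing.proj 𝒜 (D n + d) (g n * x) = c n * GradedRing.proj 𝒜 d x := by
  have hl : (g n - c n) * x ∈ degLT 𝒜 (D n + d) := mul_mem_degLT hg hx (by lia)
  have e : g n * x = (g n - c n) * x + c n * x := by ring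
  rw [e]
  refine ⟨add_mem (degLT_mono (by lia) hl)
    (by simpa only [add_assoc] using mul_mem_degLT_of_mem hc hx), ?_⟩
  rw [map_add, hl _ le_rfl, zero_add, proj_mul_of_mem hc]

theorem exists_lift_of_mem_span_leadingForm {n : ℕ} (hc : ∀ m < n, c m ∈ 𝒜 (D m))
    (hg : ∀ m < n, g m - c m ∈ degLT 𝒜 (D m)) {z : A}
    (hz : z ∈ Ideal.span (c '' Set.Iio n)) (d : ℕ) :
    ∃ y ∈ Ideal.span (g '' Set.Iio n), y ∈ degLT 𝒜 (d + 1) ∧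
      GradedRing.proj 𝒜 d y = GradedRing.proj 𝒜 d z := by
  suffices H : ∀ b : A, ∃ y ∈ Ideal.span (g '' Set.Iio n), y ∈ degLT 𝒜 (d + 1) ∧
      GradedRing.proj 𝒜 d y = GradedRing.proj 𝒜 d (b * z) by simpa using H 1
  induction hz using Submodule.span_induction with
  | mem z hz =>
    obtain ⟨m, hm, rfl⟩ := hz
    intro b
    by_cases hd : D m ≤ d
    · obtain ⟨i, rfl⟩ := Nat.exists_eq_add_of_le hd
      obtain ⟨h1, h2⟩ := mul_mem_degLT_of_leadingForm (hc m hm) (hg m hm)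
        (mem_degLT_succ_of_mem (proj_mem (𝒜 := 𝒜) i b))
      refine ⟨g m * GradedRing.proj 𝒜 i b,
        Ideal.mul_mem_right _ _ (Ideal.subset_span ⟨m, hm, rfl⟩), h1, ?_⟩
      rw [h2, mul_comm b, proj_mul_of_mem (hc m hm), proj_self_of_mem (proj_mem i b)]
    · refine ⟨0, zero_mem _, zero_mem _, ?_⟩
      rw [mul_comm b, proj_mul_of_mem_of_lt (hc m hm) _ (not_le.mp hd), map_zero]
  | zero => exact fun b => ⟨0, zero_mem _, zero_mem _, by simp⟩
  | add x y _ _ hx hy =>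
    intro b
    obtain ⟨u, hu, hu1, hu2⟩ := hx b
    obtain ⟨v, hv, hv1, hv2⟩ := hy b
    exact ⟨u + v, add_mem hu hv, add_mem hu1 hv1, by rw [map_add, hu2, hv2, mul_add, map_add]⟩
  | smul a x _ hx =>
    intro b
    simpa [mul_assoc] using hx (b * a)

theorem exists_sub_mem_degLT {n d : ℕ} (hc : ∀ m < n, c m ∈ 𝒜 (D m))
    (hg : ∀ m < n, g m - c m ∈ degLT 𝒜 (D m)) {x : A} (hx : x ∈ degLT 𝒜 (d + 1))
    (hxd : GradedRing.proj 𝒜 d x ∈ Ideal.span (c '' Set.Iio n)) :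
    ∃ y ∈ Ideal.span (g '' Set.Iio n), x - y ∈ degLT 𝒜 d := by
  obtain ⟨y, hy, hy1, hy2⟩ := exists_lift_of_mem_span_leadingForm hc hg hxd d
  refine ⟨y, hy, mem_degLT_of_succ (sub_mem hx hy1) ?_⟩
  rw [map_sub, hy2, proj_self_of_mem (proj_mem d x), sub_self]

theorem proj_mem_span_leadingForm {n : ℕ} (hc : ∀ m < n, c m ∈ 𝒜 (D m))
    (hg : ∀ m < n, g m - c m ∈ degLT 𝒜 (D m)) (hreg : WeaklyRegularUpTo c n) :
    ∀ (m : ℕ) (f : A), f ∈ Ideal.span (g '' Set.Iio n) → f ∈ degLT 𝒜 (m + 1) →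
      GradedRing.proj 𝒜 m f ∈ Ideal.span (c '' Set.Iio n) := by
  induction n with
  | zero =>
    intro m f hf _
    have : f = 0 := by simpa using hf
    simp [this]
  | succ n ih =>
    have hc' : ∀ m < n, c m ∈ 𝒜 (D m) := fun m hm => hc m (by lia)
    have hg' : ∀ m < n, g m - c m ∈ degLT 𝒜 (D m) := fun m hm => hg m (by lia)
    specialize ih hc' hg' fun m hm => hreg m (by lia)
    intro m f hf hfm
    rw [Ideal.span_image_Iio_succ, Ideal.mem_span_insert] at hf
    rw [Ideal.span_image_Iio_succ]
    have hle : Ideal.span (c '' Set.Iio n) ≤ Ideal.span (insert (c n) (c '' Set.Iio n)) :=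
      Ideal.span_mono (Set.subset_insert _ _)
    obtain ⟨a, h, hh, hfa⟩ := hf
    obtain ⟨e, he⟩ := exists_mem_degLT 𝒜 a
    induction e generalizing a h with
    | zero =>
      rw [eq_zero_of_mem_degLT_zero he, zero_mul, zero_add] at hfa
      subst hfa
      exact hle (ih m f hh hfm)
    | succ d ihd =>
      obtain ⟨h1, h2⟩ := mul_mem_degLT_of_leadingForm (hc n (by lia)) (hg n (by lia)) he
      have hf' : h = f - g n * a := by rw [hfa]; ring
      rcases lt_trichotomy (D n + d) m with hlt | heq | hgt
      · have h3 : g n * a ∈ degLT 𝒜 m := degLT_mono (by lia) h1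
        have h4 := ih m h hh (hf' ▸ sub_mem hfm (degLT_mono (by lia) h3))
        have h5 : GradedRing.proj 𝒜 m h = GradedRing.proj 𝒜 m f := by
          rw [hf', map_sub, h3 m le_rfl, sub_zero]
        exact hle (h5 ▸ h4)
      · subst heq
        have h4 := ih _ h hh (hf' ▸ sub_mem hfm h1)
        have h5 : GradedRing.proj 𝒜 (D n + d) f =
            GradedRing.proj 𝒜 d a * c n + GradedRing.proj 𝒜 (D n + d) h := by
          rw [hf', map_sub, h2]; ring
        rw [h5]
        exact add_mem (Ideal.mul_mem_left _ _ (Ideal.subset_span (Set.mem_insert _ _))) (hle h4)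
      · have h3 : f ∈ degLT 𝒜 (D n + d) := degLT_mono (by lia) hfm
        have h4 := ih _ h hh (hf' ▸ sub_mem (degLT_mono (by lia) h3) h1)
        rw [hf', map_sub, h3 _ le_rfl, h2, zero_sub, neg_mem_iff] at h4
        obtain ⟨y, hy, hy1⟩ := exists_sub_mem_degLT hc' hg' he (hreg n (by lia) _ h4)
        refine ihd (a - y) (h + g n * y) (add_mem hh (Ideal.mul_mem_left _ _ hy)) ?_ hy1
        rw [hfa]; ring

/-- If the leading forms of a sequence form a weakly regular sequence, then so does the sequence
itself. -/
theorem WeaklyRegularUpTo.of_leadingForm {N : ℕ} (hc : ∀ m < N, c m ∈ 𝒜 (D m))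
    (hg : ∀ m < N, g m - c m ∈ degLT 𝒜 (D m)) (hreg : WeaklyRegularUpTo c N) :
    WeaklyRegularUpTo g N := by
  intro n hn x hx
  have hc' : ∀ m < n, c m ∈ 𝒜 (D m) := fun m hm => hc m (by lia)
  have hg' : ∀ m < n, g m - c m ∈ degLT 𝒜 (D m) := fun m hm => hg m (by lia)
  obtain ⟨e, he⟩ := exists_mem_degLT 𝒜 x
  induction e generalizing x with
  | zero => rw [eq_zero_of_mem_degLT_zero he]; exact zero_mem _
  | succ d ih =>
    obtain ⟨h1, h2⟩ := mul_mem_degLT_of_leadingForm (hc n hn) (hg n hn) he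
    have h3 := proj_mem_span_leadingForm hc' hg' (fun m hm => hreg m (by lia)) _ _ hx h1
    rw [h2] at h3
    obtain ⟨y, hy, hy1⟩ := exists_sub_mem_degLT hc' hg' he (hreg n hn _ h3)
    have h4 := ih (x - y) (by rw [mul_sub]; exact sub_mem hx (Ideal.mul_mem_left _ _ hy)) hy1
    simpa using add_mem h4 hy

end LeadingForm

end Filtration

section ElementarySymmetric

open MvPolynomial

attribute [local instance] MvPolynomial.gradedAlgebra

theorem MvPolynomial.esymm_mem_homogeneousSubmodule (σ R : Type*) [Fintype σ] [CommRing R] (n : ℕ) :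
    esymm σ R n ∈ homogeneousSubmodule σ R n := by
  rw [mem_homogeneousSubmodule, esymm]
  refine IsHomogeneous.sum _ _ _ fun t ht => ?_
  have := IsHomogeneous.prod t (fun i : σ => (X i : MvPolynomial σ R)) (fun _ => 1)
    fun i _ => isHomogeneous_X R i
  simpa [(Finset.mem_powersetCard.mp ht).2] using this

theorem MvPolynomial.mem_map_of_C_X_mul_mem {σ S : Type*} [CommRing S]
    (J : Ideal (MvPolynomial σ S)) {x : MvPolynomial σ (Polynomial S)}
    (hx : C Polynomial.X * x ∈ J.map (map (Polynomial.C : S →+* Polynomial S))) :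
    x ∈ J.map (map (Polynomial.C : S →+* Polynomial S)) := by
  let ψ : MvPolynomial σ (Polynomial S) →+* Polynomial (MvPolynomial σ S) :=
    eval₂Hom (Polynomial.mapRingHom C) fun i => Polynomial.C (X i)
  let χ : Polynomial (MvPolynomial σ S) →+* MvPolynomial σ (Polynomial S) :=
    Polynomial.eval₂RingHom (map Polynomial.C) (C Polynomial.X)
  have h1 : χ.comp ψ = RingHom.id _ := by
    ext <;> simp [ψ, χ]
  have h2 : ψ.comp (map Polynomial.C) = Polynomial.C := by
    ext <;> simp [ψ]
  have h3 : χ.comp Polynomial.C = map Polynomial.C := by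
    ext <;> simp [χ]
  have h4 := Ideal.mem_map_of_mem ψ hx
  rw [Ideal.map_map, h2, map_mul, Ideal.mem_map_C_iff] at h4
  have h5 : ψ x ∈ J.map Polynomial.C := by
    rw [Ideal.mem_map_C_iff]
    intro n
    have := h4 (n + 1)
    simpa [ψ] using this
  have h6 := Ideal.mem_map_of_mem χ h5
  rwa [Ideal.map_map, h3, ← RingHom.comp_apply, h1] at h6

theorem MvPolynomial.aeval_cons_esymm_succ {R A : Type*} [CommRing R] [CommRing A] [Algebra R A]
    {N : ℕ} (r : A) (v : Fin N → A) (s : ℕ) :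
    aeval (Fin.cons r v : Fin (N + 1) → A) (esymm (Fin (N + 1)) R (s + 1)) =
      aeval v (esymm (Fin N) R (s + 1)) + r * aeval v (esymm (Fin N) R s) := by
  simp only [aeval_esymm_eq_multiset_esymm]
  have : (Finset.univ.val.map (Fin.cons r v : Fin (N + 1) → A)) =
      r ::ₘ Finset.univ.val.map v := by
    simp [Fin.univ_succ, Function.comp_def]
  rw [this, Multiset.esymm, Multiset.powersetCard_cons]
  simp [Multiset.esymm, Multiset.sum_map_mul_left]

theorem weaklyRegularUpTo_esymm_fin (N : ℕ) : ∀ (S : Type u) [CommRing S],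
    WeaklyRegularUpTo (fun s => esymm (Fin N) S (s + 1)) N := by
  induction N with
  | zero => intro S _ n hn; lia
  | succ N ih =>
    intro S _
    let B := MvPolynomial (Fin N) (Polynomial S)
    let r : B := C Polynomial.X
    let f : MvPolynomial (Fin (N + 1)) S →+* B := (aeval (Fin.cons r X : Fin (N + 1) → B)).toRingHom
    let f' : B →+* MvPolynomial (Fin (N + 1)) S :=
      eval₂Hom (Polynomial.aeval (X 0)).toRingHom fun i => X i.succ
    have hf : f.IdealPure := by
      refine .of_leftInverse f f' fun x => ?_
      have hf'C : ∀ a, f' (C a) = Polynomial.aeval (X 0) a := fun a => eval₂Hom_C _ _ a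
      have hf'X : ∀ i, f' (X i) = X i.succ := fun i => eval₂Hom_X' _ _ i
      have hfX : ∀ i, f (X i) = (Fin.cons r X : Fin (N + 1) → B) i := fun i => aeval_X _ i
      have hfC : ∀ a, f (C a) = C (Polynomial.C a) := fun a => aeval_C _ a
      have : f'.comp f = RingHom.id _ := by
        apply ringHom_ext
        · intro a
          rw [RingHom.comp_apply, hfC, hf'C, Polynomial.aeval_C]
          rfl
        · intro i
          rw [RingHom.comp_apply, hfX]
          cases i using Fin.cases with
          | zero => rw [Fin.cons_zero, hf'C, Polynomial.aeval_X, RingHom.id_apply]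
          | succ i => rw [Fin.cons_succ, hf'X, RingHom.id_apply]
      exact DFunLike.congr_fun this x
    refine hf.weaklyRegularUpTo ?_
    let e : ℕ → B := fun s => esymm (Fin N) (Polynomial S) s
    let γ : ℕ → B := fun s => e (s + 1) + r * e s
    have hγ : ∀ s, f (esymm (Fin (N + 1)) S (s + 1)) = γ s := by
      intro s
      have he : ∀ s, aeval (X : Fin N → B) (esymm (Fin N) S s) = e s := by
        intro s
        simp [e, esymm]
      simp only [f, γ, ← he]
      exact aeval_cons_esymm_succ r X s
    simp only [hγ]
    set I := Ideal.span (γ '' Set.Iio N) with hI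
    have hpow : ∀ s ≤ N, e s - (-r) ^ s ∈ I := by
      intro s hs
      induction s with
      | zero => simp [e]
      | succ s ihs =>
        have h1 : γ s ∈ I := Ideal.subset_span ⟨s, by simpa using hs, rfl⟩
        have h2 := sub_mem h1 (Ideal.mul_mem_left I r (ihs (by lia)))
        convert h2 using 1
        simp only [γ]
        ring
    have hlast : γ N + (-r) ^ (N + 1) ∈ I := by
      have h0 : e (N + 1) = 0 := by
        simp only [e, esymm]
        rw [Finset.powersetCard_eq_empty.mpr (by simp), Finset.sum_empty]
      have := Ideal.mul_mem_left I r (hpow N le_rfl)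
      convert this using 1
      simp only [γ, h0]
      ring
    let c : ℕ → B := fun s => if s < N then e (s + 1) else r ^ (N + 1)
    let g : ℕ → B := fun s => if s < N then γ s else r ^ (N + 1)
    let D : ℕ → ℕ := fun s => if s < N then s + 1 else 0
    have hr : r ∈ homogeneousSubmodule (Fin N) (Polynomial S) 0 := by
      rw [mem_homogeneousSubmodule]
      exact isHomogeneous_C _ _
    have hrpow : r ^ (N + 1) ∈ homogeneousSubmodule (Fin N) (Polynomial S) 0 := by
      simpa using SetLike.pow_mem_graded (N + 1) hr
    have hcreg : WeaklyRegularUpTo c (N + 1) := by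
      have hcim : ∀ n ≤ N, c '' Set.Iio n = (fun s => e (s + 1)) '' Set.Iio n := fun n hn =>
        Set.image_congr fun m hm => if_pos (lt_of_lt_of_le hm hn)
      intro n hn x hx
      rw [hcim n (by lia)] at hx ⊢
      rcases (Nat.lt_succ_iff.mp hn).lt_or_eq with hn | rfl
      · simp only [c, if_pos hn] at hx
        exact ih (Polynomial S) n hn x hx
      · simp only [c, lt_irrefl, if_false] at hx
        have hJ : Ideal.span ((fun s => e (s + 1)) '' Set.Iio n) =
            (Ideal.span ((fun s => esymm (Fin n) S (s + 1)) '' Set.Iio n)).map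
              (map (Polynomial.C : S →+* Polynomial S)) := by
          rw [Ideal.map_span, Set.image_image]
          simp only [map_esymm, e]
          rfl
        rw [hJ] at hx ⊢
        generalize n + 1 = k at hx
        induction k with
        | zero => simpa using hx
        | succ k ihk =>
          rw [pow_succ', mul_assoc] at hx
          exact ihk (mem_map_of_C_X_mul_mem _ hx)
    have hgreg : WeaklyRegularUpTo g (N + 1) := by
      refine WeaklyRegularUpTo.of_leadingForm (𝒜 := homogeneousSubmodule (Fin N) (Polynomial S))
        (c := c) (D := D) ?_ ?_ hcreg
      · intro m _
        by_cases hm : m < N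
        · simpa only [c, D, if_pos hm] using esymm_mem_homogeneousSubmodule _ _ _
        · simpa only [c, D, if_neg hm] using hrpow
      · intro m _
        by_cases hm : m < N
        · simp only [g, c, D, γ, if_pos hm, add_sub_cancel_left]
          have := mul_mem_degLT_of_mem hr
            (mem_degLT_succ_of_mem (esymm_mem_homogeneousSubmodule (Fin N) (Polynomial S) m))
          simpa only [zero_add] using this
        · simp only [g, c, if_neg hm, sub_self, zero_mem]
    have hgim : ∀ n ≤ N, g '' Set.Iio n = γ '' Set.Iio n := fun n hn =>
        Set.image_congr fun m hm => if_pos (lt_of_lt_of_le hm hn)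
    intro n hn x hx
    rcases (Nat.lt_succ_iff.mp hn).lt_or_eq with hn' | rfl
    · have := hgreg n hn x
      rw [hgim n hn'.le] at this
      simp only [g, if_pos hn'] at this
      exact this hx
    · have := hgreg n hn x
      rw [hgim n le_rfl] at this
      simp only [g, lt_irrefl, if_false] at this
      refine this ?_
      have h1 := sub_mem (Ideal.mul_mem_right x I hlast) hx
      rw [← sub_mul, add_sub_cancel_left] at h1
      have h2 := Ideal.mul_mem_left I ((-1) ^ (n + 1)) h1
      have h3 : (-1) ^ (n + 1) * ((-r) ^ (n + 1) * x) = r ^ (n + 1) * x := by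
        rw [← mul_assoc, ← mul_pow]
        congr 2
        ring
      exact h3 ▸ h2

theorem weaklyRegularUpTo_esymm (σ : Type*) [Fintype σ] (S : Type u) [CommRing S] :
    WeaklyRegularUpTo (fun s => esymm σ S (s + 1)) (Fintype.card σ) := by
  let e := renameEquiv S (Fintype.equivFin σ)
  refine (RingHom.IdealPure.of_leftInverse e.toRingEquiv.toRingHom
    e.symm.toRingEquiv.toRingHom e.symm_apply_apply).weaklyRegularUpTo ?_
  have : ∀ s, e.toRingEquiv.toRingHom (esymm σ S s) = esymm (Fin (Fintype.card σ)) S s :=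
    fun s => rename_esymm σ S s (Fintype.equivFin σ)
  simpa only [this] using weaklyRegularUpTo_esymm_fin (Fintype.card σ) S

theorem MvPolynomial.idealPure_aeval_esymm (p : ℕ) (R : Type*) [CommRing R]
    (hp : IsUnit (p.factorial : R)) :
    (aeval fun i : Fin p => esymm (Fin p) R (i + 1) :
      MvPolynomial (Fin p) R →ₐ[R] MvPolynomial (Fin p) R).toRingHom.IdealPure := by
  let E := esymmAlgEquiv (Fin p) R (Fintype.card_fin p)
  let f : MvPolynomial (Fin p) R →ₐ[R] MvPolynomial (Fin p) R :=
    aeval fun i : Fin p => esymm (Fin p) R (i + 1)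
  have hE : ∀ a, (E a : MvPolynomial (Fin p) R) = f a := fun a => esymmAlgHom_apply a
  let avg : MvPolynomial (Fin p) R → symmetricSubalgebra (Fin p) R := fun b =>
    ⟨∑ e : Equiv.Perm (Fin p), rename e b, fun e' => by
      simp only [map_sum, rename_rename, ← Equiv.Perm.coe_mul]
      exact Fintype.sum_equiv (Equiv.mulLeft e') _ _ fun _ => rfl⟩
  have havg_add : ∀ a b, avg (a + b) = avg a + avg b := fun a b =>
    Subtype.ext (by simp [avg, Finset.sum_add_distrib])
  have havg_mul : ∀ a b, avg (f a * b) = E a * avg b := by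
    intro a b
    refine Subtype.ext ?_
    have hsym : ∀ e : Equiv.Perm (Fin p), rename e (f a) = f a := by
      rw [← hE]
      exact (E a).2
    simp [avg, Finset.mul_sum, hsym, hE]
  intro I x hx
  have key : ∀ b, E.symm (avg (f x * b)) ∈ I := by
    intro b
    change f x ∈ I.map f.toRingHom at hx
    generalize f x = y at hx
    induction hx using Submodule.span_induction generalizing b with
    | mem y hy =>
      obtain ⟨a, ha, rfl⟩ := hy
      change E.symm (avg (f a * b)) ∈ I
      rw [havg_mul, map_mul, AlgEquiv.symm_apply_apply]
      exact Ideal.mul_mem_right _ _ ha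
    | zero =>
      have : avg 0 = 0 := by simpa using havg_add 0 0
      simp [this]
    | add y z _ _ hy hz =>
      rw [add_mul, havg_add, map_add]
      exact add_mem (hy b) (hz b)
    | smul a y _ hy =>
      rw [smul_eq_mul, mul_comm a, mul_assoc]
      exact hy (a * b)
  have h1 := key 1
  have h2 : avg 1 = (p.factorial : symmetricSubalgebra (Fin p) R) :=
    Subtype.ext (by simp [avg, Fintype.card_perm])
  rw [havg_mul, map_mul, AlgEquiv.symm_apply_apply, h2, map_natCast, mul_comm] at h1
  have hu : IsUnit (p.factorial : MvPolynomial (Fin p) R) := by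
    simpa using hp.map (C : R →+* MvPolynomial (Fin p) R)
  exact (Ideal.unit_mul_mem_iff_mem I hu).mp h1

end ElementarySymmetric

section Blocks

open MvPolynomial

variable {ι : Type*} [DecidableEq ι] (p : ℕ) (S : Type*) [CommRing S]

/-- The substitution replacing, for each block `i ∈ F`, the variables `X (i, m)` by the elementary
symmetric polynomials in the variables of that block. -/
noncomputable def blockEsymm (F : Finset ι) :
    MvPolynomial (ι × Fin p) S →ₐ[S] MvPolynomial (ι × Fin p) S :=
  aeval fun q => if q.1 ∈ F then rename (Prod.mk q.1) (esymm (Fin p) S (q.2 + 1)) else X q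

theorem blockEsymm_insert {i : ι} {F : Finset ι} (hi : i ∉ F) :
    blockEsymm p S (insert i F) = (blockEsymm p S {i}).comp (blockEsymm p S F) := by
  apply algHom_ext
  rintro ⟨j, m⟩
  by_cases hj : j ∈ F
  · have hji : j ≠ i := fun h => hi (h ▸ hj)
    have h : (blockEsymm p S {i}).comp (rename (Prod.mk j)) = rename (Prod.mk j) := by
      apply algHom_ext
      intro l
      simp [blockEsymm, hji]
    have h' := DFunLike.congr_fun h (esymm (Fin p) S (m + 1))
    simp only [AlgHom.comp_apply] at h' ⊢
    simp only [blockEsymm, aeval_X, hj, Finset.mem_insert, or_true, if_true] at h' ⊢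
    exact h'.symm
  · by_cases hji : j = i
    · subst hji
      simp [blockEsymm, hj]
    · simp [blockEsymm, hj, hji]

variable {S} in
theorem idealPure_blockEsymm_singleton (hp : IsUnit (p.factorial : S)) (i : ι) :
    (blockEsymm p S {i}).toRingHom.IdealPure := by
  let B := MvPolynomial (ι × Fin p) S
  let f : B →ₐ[S] MvPolynomial (Fin p) B :=
    aeval fun q => if q.1 = i then X q.2 else C (X q)
  let f' : MvPolynomial (Fin p) B →+* B := eval₂Hom (RingHom.id B) fun j => X (i, j)
  have hfX : ∀ q, f (X q) = if q.1 = i then X q.2 else C (X q) := fun q => aeval_X _ q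
  have hf'C : ∀ b, f' (C b) = b := fun b => eval₂Hom_C _ _ b
  have hf'X : ∀ j, f' (X j) = X (i, j) := fun j => eval₂Hom_X' _ _ j
  have hf : f.toRingHom.IdealPure := by
    refine .of_leftInverse _ f' fun x => ?_
    have : f'.comp f.toRingHom = RingHom.id _ := by
      apply ringHom_ext
      · intro a
        exact (congrArg f' (f.commutes a)).trans (hf'C _)
      · rintro ⟨j, m⟩
        refine (congrArg f' (hfX _)).trans ?_
        by_cases hj : j = i
        · subst hj
          simp only [if_true, hf'X]
          rfl
        · simp only [hj, if_false, hf'C]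
          rfl
    exact DFunLike.congr_fun this x
  have hB : IsUnit (p.factorial : B) := by
    simpa using hp.map (C : S →+* B)
  let sym : MvPolynomial (Fin p) B →ₐ[B] MvPolynomial (Fin p) B :=
    aeval fun i : Fin p => esymm (Fin p) B (i + 1)
  have hcomm : f.toRingHom.comp (blockEsymm p S {i}).toRingHom =
      sym.toRingHom.comp f.toRingHom := by
    suffices H : f.comp (blockEsymm p S {i}) = (sym.restrictScalars S).comp f from
      RingHom.ext fun x => DFunLike.congr_fun H x
    apply algHom_ext
    rintro ⟨j, m⟩
    change f (blockEsymm p S {i} (X (j, m))) = sym (f (X (j, m)))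
    rw [hfX, blockEsymm, aeval_X]
    by_cases hj : j = i
    · subst hj
      simp only [Finset.mem_singleton, if_true, esymm, map_sum, map_prod, rename_X, hfX]
      exact (aeval_X (fun i : Fin p => esymm (Fin p) B (i + 1)) m).symm
    · simp only [Finset.mem_singleton, hj, if_false, hfX]
      exact (sym.commutes _).symm
  refine .of_comp (g := f.toRingHom) ?_
  rw [hcomm]
  exact (idealPure_aeval_esymm p B hB).comp hf

variable {S} in
theorem idealPure_blockEsymm (hp : IsUnit (p.factorial : S)) (F : Finset ι) :
    (blockEsymm p S F).toRingHom.IdealPure := by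
  induction F using Finset.induction_on with
  | empty =>
    refine .of_leftInverse _ (RingHom.id _) fun x => ?_
    have : blockEsymm p S (∅ : Finset ι) = AlgHom.id S _ := by
      apply algHom_ext
      simp [blockEsymm]
    exact DFunLike.congr_fun this x
  | insert i F hi ih =>
    rw [blockEsymm_insert p S hi]
    exact (idealPure_blockEsymm_singleton p hp i).comp ih

end Blocks

section Determinant

variable {A σ : Type*} [CommRing A] [SetLike σ A] [AddSubmonoidClass σ A] (𝒜 : ℕ → σ)
  [GradedRing 𝒜]

/-- The polynomials over a graded ring of total degree at most `m`, where the polynomial variable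
has degree one. -/
def polyDegLE (m : ℕ) : AddSubgroup (Polynomial A) where
  carrier := {f | ∀ j, f.coeff j ∈ degLT 𝒜 (m + 1 - j)}
  zero_mem' j := by simp
  add_mem' := by
    intro f g hf hg j
    rw [Polynomial.coeff_add]
    exact add_mem (hf j) (hg j)
  neg_mem' := by
    intro f hf j
    rw [Polynomial.coeff_neg]
    exact neg_mem (hf j)

variable {𝒜}

theorem coeff_mem_degLT {m : ℕ} {f : Polynomial A} (hf : f ∈ polyDegLE 𝒜 m) (j : ℕ) :
    f.coeff j ∈ degLT 𝒜 (m + 1 - j) := hf j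

theorem polyDegLE_mono {m n : ℕ} (h : m ≤ n) : polyDegLE 𝒜 m ≤ polyDegLE 𝒜 n :=
  fun _ hf j => degLT_mono (by lia) (hf j)

theorem mul_mem_polyDegLE {a b : ℕ} {f g : Polynomial A} (hf : f ∈ polyDegLE 𝒜 a)
    (hg : g ∈ polyDegLE 𝒜 b) : f * g ∈ polyDegLE 𝒜 (a + b) := by
  intro j
  rw [Polynomial.coeff_mul]
  refine sum_mem fun x hx => ?_
  have hx := Finset.HasAntidiagonal.mem_antidiagonal.mp hx
  have h1 := hf x.1
  have h2 := hg x.2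
  by_cases ha : a < x.1
  · rw [Nat.sub_eq_zero_of_le ha] at h1
    rw [eq_zero_of_mem_degLT_zero h1, zero_mul]
    exact zero_mem _
  by_cases hb : b < x.2
  · rw [Nat.sub_eq_zero_of_le hb] at h2
    rw [eq_zero_of_mem_degLT_zero h2, mul_zero]
    exact zero_mem _
  exact mul_mem_degLT h1 h2 (by lia)

theorem one_mem_polyDegLE : (1 : Polynomial A) ∈ polyDegLE 𝒜 0 := by
  intro j
  rw [Polynomial.coeff_one]
  split_ifs with h
  · subst h
    exact mem_degLT_succ_of_mem SetLike.GradedOne.one_mem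
  · exact zero_mem _

theorem prod_mem_polyDegLE {ι : Type*} (s : Finset ι) (f : ι → Polynomial A) (m : ι → ℕ)
    (h : ∀ i ∈ s, f i ∈ polyDegLE 𝒜 (m i)) : ∏ i ∈ s, f i ∈ polyDegLE 𝒜 (∑ i ∈ s, m i) := by
  classical
  induction s using Finset.induction_on with
  | empty => simpa using one_mem_polyDegLE
  | insert i s hi ih =>
    rw [Finset.prod_insert hi, Finset.sum_insert hi]
    exact mul_mem_polyDegLE (h i (Finset.mem_insert_self _ _))
      (ih fun j hj => h j (Finset.mem_insert_of_mem hj))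

theorem X_add_C_mem_polyDegLE {a : A} (ha : a ∈ 𝒜 1) :
    Polynomial.X + Polynomial.C a ∈ polyDegLE 𝒜 1 := by
  refine add_mem (fun j => ?_) (fun j => ?_)
  · rw [Polynomial.coeff_X]
    split_ifs with h
    · subst h
      exact mem_degLT_succ_of_mem SetLike.GradedOne.one_mem
    · exact zero_mem _
  · rw [Polynomial.coeff_C]
    split_ifs with h
    · subst h
      exact mem_degLT_succ_of_mem ha
    · exact zero_mem _

theorem C_mul_X_pow_mem_polyDegLE {a : A} (ha : a ∈ 𝒜 0) (m : ℕ) :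
    Polynomial.C a * Polynomial.X ^ m ∈ polyDegLE 𝒜 m := by
  intro j
  rw [Polynomial.coeff_C_mul_X_pow]
  split_ifs with h
  · subst h
    exact degLT_mono (by lia) (mem_degLT_succ_of_mem ha)
  · exact zero_mem _

theorem det_sub_prod_diag_mem_polyDegLE {ι : Type*} [Fintype ι] [DecidableEq ι]
    (M : Matrix ι ι (Polynomial A)) {p : ℕ} (hp : 1 ≤ p) (hdiag : ∀ i, M i i ∈ polyDegLE 𝒜 p)
    (hoff : ∀ i j, i ≠ j → M i j ∈ polyDegLE 𝒜 (p - 1)) :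
    M.det - ∏ i, M i i ∈ polyDegLE 𝒜 (Fintype.card ι * p - 1) := by
  rw [Matrix.det_apply, ← Finset.add_sum_erase _ _ (Finset.mem_univ 1)]
  simp only [Equiv.Perm.sign_one, one_smul, Equiv.Perm.one_apply, add_sub_cancel_left]
  refine sum_mem fun τ hτ => ?_
  have hprod : ∏ i, M (τ i) i ∈ polyDegLE 𝒜 (Fintype.card ι * p - 1) := by
    have hM : ∀ i ∈ Finset.univ, M (τ i) i ∈ polyDegLE 𝒜 (if τ i = i then p else p - 1) := by
      intro i _
      by_cases h : τ i = i
      · rw [if_pos h, h]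
        exact hdiag i
      · rw [if_neg h]
        exact hoff _ _ h
    have h := prod_mem_polyDegLE _ _ _ hM
    refine polyDegLE_mono (Nat.le_sub_one_of_lt ?_) h
    obtain ⟨i, hi⟩ : ∃ i, τ i ≠ i := by
      by_contra! hcon
      exact (Finset.mem_erase.mp hτ).1 (Equiv.ext hcon)
    calc ∑ i, (if τ i = i then p else p - 1) < ∑ _i : ι, p :=
          Finset.sum_lt_sum (fun j _ => by split_ifs <;> lia) ⟨i, Finset.mem_univ _, by
            rw [if_neg hi]; lia⟩
      _ = Fintype.card ι * p := by simp
  rcases Int.units_eq_one_or (Equiv.Perm.sign τ) with h | h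
  · rwa [h, one_smul]
  · rw [h, Units.neg_smul, one_smul]
    exact neg_mem hprod

end Determinant

section GenericMatrix

open MvPolynomial

attribute [local instance] MvPolynomial.gradedAlgebra

theorem weaklyRegularUpTo_coeff_det {n p : ℕ} (hp : 1 ≤ p) {S : Type u} [CommRing S]
    (M : Matrix (Fin n) (Fin n) (Polynomial (MvPolynomial (Fin n × Fin p) S)))
    (hdiag : ∀ i, M i i = ∏ j, (Polynomial.X + Polynomial.C (X (i, j))))
    (hoff : ∀ i j, i ≠ j →
      M i j ∈ polyDegLE (homogeneousSubmodule (Fin n × Fin p) S) (p - 1)) :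
    WeaklyRegularUpTo (fun s => M.det.coeff (n * p - (s + 1))) (n * p) := by
  have hreg := weaklyRegularUpTo_esymm (Fin n × Fin p) S
  have hcard : Fintype.card (Fin n × Fin p) = n * p := by simp
  rw [hcard] at hreg
  refine WeaklyRegularUpTo.of_leadingForm (𝒜 := homogeneousSubmodule (Fin n × Fin p) S)
    (D := fun s => s + 1) (fun s _ => esymm_mem_homogeneousSubmodule _ _ _) ?_ hreg
  intro s hs
  have hdiag' : ∀ i, M i i ∈ polyDegLE (homogeneousSubmodule (Fin n × Fin p) S) p := by
    intro i
    have h := prod_mem_polyDegLE (𝒜 := homogeneousSubmodule (Fin n × Fin p) S) Finset.univ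
      (fun j : Fin p => Polynomial.X + Polynomial.C (X (i, j))) (fun _ => 1)
      fun j _ => X_add_C_mem_polyDegLE (isHomogeneous_X S (i, j))
    rwa [Finset.sum_const, Finset.card_univ, Fintype.card_fin, smul_eq_mul, mul_one, ← hdiag] at h
  have hdet := coeff_mem_degLT (det_sub_prod_diag_mem_polyDegLE M hp hdiag' hoff)
    (n * p - (s + 1))
  have hprod : ∏ i, M i i = ∏ q : Fin n × Fin p, (Polynomial.X + Polynomial.C (X q)) := by
    simp only [hdiag, Fintype.prod_prod_type]
  rw [Polynomial.coeff_sub, hprod, MvPolynomial.prod_X_add_C_coeff _ _ _ (by lia), hcard,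
    Fintype.card_fin] at hdet
  have h1 : n * p - (n * p - (s + 1)) = s + 1 := by lia
  have h2 : n * p - 1 + 1 - (n * p - (s + 1)) = s + 1 := by lia
  rwa [h1, h2] at hdet

variable (n p : ℕ) (k : Type u) [Field k]

/-- The embedding of the coordinate ring of generic matrix polynomials into a polynomial ring in
new variables over itself, renaming the variables of the diagonal entries. -/
noncomputable def diagEmbedding : MvPolynomial (Fin n × Fin n × Fin p) k →+*
    MvPolynomial (Fin n × Fin p) (MvPolynomial (Fin n × Fin n × Fin p) k) :=
  eval₂Hom (C.comp C) fun q => if q.1 = q.2.1 then X (q.1, q.2.2) else C (X q)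

theorem idealPure_diagEmbedding : (diagEmbedding n p k).IdealPure := by
  let r : MvPolynomial (Fin n × Fin p) (MvPolynomial (Fin n × Fin n × Fin p) k) →+*
      MvPolynomial (Fin n × Fin n × Fin p) k :=
    eval₂Hom (RingHom.id _) fun q => X (q.1, q.1, q.2)
  have h : r.comp (diagEmbedding n p k) = RingHom.id _ := by
    apply ringHom_ext
    · intro a
      simp [r, diagEmbedding]
    · rintro ⟨i, j, m⟩
      by_cases h : i = j
      · subst h
        simp [r, diagEmbedding]
      · simp [r, diagEmbedding, h]
  exact .of_leftInverse _ r fun x => DFunLike.congr_fun h x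

/-- The ring homomorphism splitting the diagonal entries of the generic matrix polynomial into
linear factors. -/
noncomputable def diagSplitting : MvPolynomial (Fin n × Fin n × Fin p) k →+*
    MvPolynomial (Fin n × Fin p) (MvPolynomial (Fin n × Fin n × Fin p) k) :=
  (blockEsymm p _ Finset.univ).toRingHom.comp (diagEmbedding n p k)

theorem idealPure_diagSplitting [CharZero k] : (diagSplitting n p k).IdealPure := by
  refine (idealPure_blockEsymm p ?_ _).comp (idealPure_diagEmbedding n p k)
  have : IsUnit (p.factorial : k) := (Nat.cast_ne_zero.mpr p.factorial_ne_zero).isUnit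
  simpa using this.map (C : k →+* MvPolynomial (Fin n × Fin n × Fin p) k)

variable {n p k}

theorem diagSplitting_X_diag (i : Fin n) (m : Fin p) :
    diagSplitting n p k (X (i, i, m)) = rename (Prod.mk i) (esymm (Fin p) _ (m + 1)) := by
  simp [diagSplitting, diagEmbedding, blockEsymm]

theorem diagSplitting_X_of_ne {i j : Fin n} (h : i ≠ j) (m : Fin p) :
    diagSplitting n p k (X (i, j, m)) = C (X (i, j, m)) := by
  simp [diagSplitting, diagEmbedding, blockEsymm, h]

theorem prod_X_add_C_block {ι S : Type*} [CommRing S] (i : ι) :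
    ∏ j : Fin p, (Polynomial.X + Polynomial.C (X (i, j) : MvPolynomial (ι × Fin p) S)) =
      Polynomial.X ^ p + ∑ m : Fin p,
        Polynomial.C (rename (Prod.mk i) (esymm (Fin p) S (m + 1))) *
          Polynomial.X ^ (p - ((m : ℕ) + 1)) := by
  have h := congrArg (Polynomial.mapRingHom
    (rename (R := S) (Prod.mk i : Fin p → ι × Fin p)).toRingHom)
    (MvPolynomial.prod_C_add_X_eq_sum_esymm S (Fin p))
  simp only [map_prod, map_sum, map_add, map_mul, map_pow, Polynomial.coe_mapRingHom,
    Polynomial.map_X, Polynomial.map_C, Fintype.card_fin, Finset.sum_range_succ',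
    AlgHom.toRingHom_eq_coe, RingHom.coe_coe, rename_X, esymm_zero, map_one, one_mul,
    Nat.sub_zero] at h
  rw [h, add_comm, Fin.sum_univ_eq_sum_range fun m =>
    Polynomial.C (rename (Prod.mk i) (esymm (Fin p) S (m + 1))) * Polynomial.X ^ (p - (m + 1))]

variable (n p k) in
/-- The generic matrix polynomial of size `n`, monic of degree `p`. -/
noncomputable def genericMatrix :
    Matrix (Fin n) (Fin n) (Polynomial (MvPolynomial (Fin n × Fin n × Fin p) k)) :=
  Matrix.of fun i j : Fin n =>
    ((if i = j then
        (Polynomial.X : Polynomial (MvPolynomial (Fin n × Fin n × Fin p) k)) ^ p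
      else 0) +
      ∑ m : Fin p,
        Polynomial.C (MvPolynomial.X (i, j, m)) *
          Polynomial.X ^ (p - ((m : ℕ) + 1)))

theorem coeff_det_genericMatrix_mem_ker {j : ℕ} (hj : j ≠ n * p) :
    (genericMatrix n p k).det.coeff j ∈
      RingHom.ker (constantCoeff : MvPolynomial (Fin n × Fin n × Fin p) k →+* k) := by
  have h : (Polynomial.mapRingHom constantCoeff).mapMatrix (genericMatrix n p k) =
      Matrix.diagonal fun _ => Polynomial.X ^ p := by
    ext1 i j
    by_cases hij : i = j
    · subst hij
      simp [genericMatrix, Polynomial.map_sum]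
    · simp [genericMatrix, Polynomial.map_sum, hij]
  rw [RingHom.mem_ker, ← Polynomial.coeff_map, ← Polynomial.coe_mapRingHom, RingHom.map_det, h,
    Matrix.det_diagonal, Finset.prod_const, Finset.card_univ, Fintype.card_fin, ← pow_mul,
    mul_comm p n, Polynomial.coeff_X_pow, if_neg hj]

theorem weaklyRegularUpTo_coeff_det_genericMatrix [CharZero k] (hp : 1 ≤ p) :
    WeaklyRegularUpTo (fun s => (genericMatrix n p k).det.coeff (n * p - (s + 1))) (n * p) := by
  refine (idealPure_diagSplitting n p k).weaklyRegularUpTo ?_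
  have hcoeff : ∀ j, diagSplitting n p k ((genericMatrix n p k).det.coeff j) =
      ((Polynomial.mapRingHom (diagSplitting n p k)).mapMatrix (genericMatrix n p k)).det.coeff j :=
    fun j => by rw [← RingHom.map_det, Polynomial.coe_mapRingHom, Polynomial.coeff_map]
  simp only [hcoeff]
  refine weaklyRegularUpTo_coeff_det hp _ (fun i => ?_) fun i j hij => ?_
  · rw [prod_X_add_C_block]
    simp [genericMatrix, Polynomial.map_sum, diagSplitting_X_diag]
  · have h : (Polynomial.mapRingHom (diagSplitting n p k)).mapMatrix (genericMatrix n p k) i j =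
        ∑ m : Fin p, Polynomial.C (C (X (i, j, m))) * Polynomial.X ^ (p - ((m : ℕ) + 1)) := by
      simp [genericMatrix, Polynomial.map_sum, diagSplitting_X_of_ne hij, hij]
    rw [h]
    exact sum_mem fun m _ => polyDegLE_mono (by lia)
      (C_mul_X_pow_mem_polyDegLE (isHomogeneous_C _ _) _)

end GenericMatrix

/-- Let `Λ = k[X_ij^(k)]` be the polynomial algebra in `n²p` variables,
`X_ij(u) = δ_ij u^p + Σ_{k=1}^p X_ij^(k) u^{p-k}`, `X(u)` the `n × n` matrix `(X_ij(u))`,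
and `d̄_s` the coefficient of `u^{np-s}` in `det X(u)` for `s = 1, …, np`. Then
`d̄_1, …, d̄_np` is a regular sequence in `Λ`. -/
theorem statement16 {k : Type u} [Field k] [IsAlgClosed k] [CharZero k]
    (n p : ℕ) (hn : 1 ≤ n) (hp : 1 ≤ p) :
    IsRegularSequence (fun s : Fin (n * p) =>
      (Matrix.det (Matrix.of fun i j : Fin n =>
          ((if i = j then
              (Polynomial.X : Polynomial (MvPolynomial (Fin n × Fin n × Fin p) k)) ^ p
            else 0) +
            ∑ m : Fin p,
              Polynomial.C (MvPolynomial.X (i, j, m)) *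
                Polynomial.X ^ (p - ((m : ℕ) + 1))))).coeff
        (n * p - ((s : ℕ) + 1))) := by
  intro i
  have himg : ∀ t : ℕ → MvPolynomial (Fin n × Fin n × Fin p) k,
      (fun s : Fin (n * p) => t s) '' {j | j < i} = t '' Set.Iio (i : ℕ) := by
    intro t
    ext x
    constructor
    · rintro ⟨j, hj, rfl⟩
      exact ⟨j, hj, rfl⟩
    · rintro ⟨j, hj, rfl⟩
      exact ⟨⟨j, lt_trans hj i.isLt⟩, hj, rfl⟩
  refine ⟨fun x hx => ?_, fun htop => ?_⟩
  · have h := weaklyRegularUpTo_coeff_det_genericMatrix (n := n) (k := k) hp i i.isLt x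
    rw [← himg] at h
    exact h hx
  · refine RingHom.ker_ne_top
      (MvPolynomial.constantCoeff : MvPolynomial (Fin n × Fin n × Fin p) k →+* k)
      (top_le_iff.mp (htop ▸ Ideal.span_le.mpr ?_))
    rintro _ ⟨j, -, rfl⟩
    exact coeff_det_genericMatrix_mem_ker (by have := j.isLt; lia)

end
end
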